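/- arXiv:1412.7290 — 2 statements merged into one kernel-verified Lean document; each statement's English description precedes it below -/
import Mathlib

section
/- Let C be an (X,s)-neighbour transitive code in H(m,q) with minimum distance δ. Then for each i with 1 ≤ i ≤ min{s, ⌊(δ−1)/2⌋} and each i-subset I of M, the setwise stabiliser X_I of I (under the action of X on entries) acts transitively on C. -/
open Equiv

namespace NT

/-- Vertices of the Hamming graph `H(m,q)`. -/
abbrev V (m q : ℕ) := Fin m → Fin q

/-- The automorphism of `H(m,q)` determined by alphabet permutations `g` and
an entry permutation `σ`:  `α ↦ (i ↦ gᵢ (α (σ⁻¹ i)))`. -/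
def hAut (m q : ℕ) (g : Fin m → Perm (Fin q)) (σ : Perm (Fin m)) :
    Perm (V m q) where
  toFun α := fun i => g i (α (σ⁻¹ i))
  invFun α := fun i => (g (σ i))⁻¹ (α (σ i))
  left_inv α := by funext i; simp
  right_inv α := by funext i; simp

/-- The automorphism group of the Hamming graph, as a subgroup of the group of
all permutations of the vertex set:  `S_q^m ⋊ S_m`. -/
def HammingAut (m q : ℕ) : Subgroup (Perm (V m q)) where
  carrier := {x | ∃ g σ, x = hAut m q g σ}
  one_mem' := ⟨fun _ => 1, 1, by ext α i; simp [hAut]⟩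
  mul_mem' := by
    rintro x y ⟨g, σ, rfl⟩ ⟨h, τ, rfl⟩
    exact ⟨fun i => g i * h (σ⁻¹ i), σ * τ, by ext α i; simp [hAut, Perm.mul_apply]⟩
  inv_mem' := by
    rintro x ⟨g, σ, rfl⟩
    refine ⟨fun i => (g (σ i))⁻¹, σ⁻¹, ?_⟩
    ext α i
    simp [hAut, Perm.inv_def]

/-- The minimum distance of a code `C ⊆ H(m,q)`. -/
noncomputable def minDist (m q : ℕ) (C : Set (V m q)) : ℕ :=
  sInf {d | ∃ α ∈ C, ∃ β ∈ C, α ≠ β ∧ hammingDist α β = d}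

/-- The distance `d(α, C)` from a vertex to a code. -/
noncomputable def distTo (m q : ℕ) (C : Set (V m q)) (α : V m q) : ℕ :=
  sInf {d | ∃ β ∈ C, hammingDist α β = d}

/-- `C_r`, the set of vertices at distance exactly `r` from the code `C`. -/
def cell (m q : ℕ) (C : Set (V m q)) (r : ℕ) : Set (V m q) :=
  {α | distTo m q C α = r}

/-- The covering radius of a code. -/
noncomputable def covRad (m q : ℕ) (C : Set (V m q)) : ℕ :=
  sSup (Set.range (distTo m q C))

/-- `S` is an orbit of the subgroup `X ≤ Sym(V)`. -/
def IsOrbit (m q : ℕ) (X : Subgroup (Perm (V m q))) (S : Set (V m q)) : Prop :=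
  S.Nonempty ∧ (∀ x ∈ X, ∀ ν ∈ S, x ν ∈ S) ∧
    ∀ ν ∈ S, ∀ μ ∈ S, ∃ x ∈ X, x ν = μ

/-- `C` is `(X,s)`-neighbour transitive:  `X` is a group of automorphisms of the
Hamming graph and each of `C, C_1, …, C_s` is an `X`-orbit. -/
def IsNT (m q : ℕ) (X : Subgroup (Perm (V m q))) (C : Set (V m q)) (s : ℕ) : Prop :=
  X ≤ HammingAut m q ∧ IsOrbit m q X C ∧
    ∀ i, 1 ≤ i → i ≤ s → IsOrbit m q X (cell m q C i)

/-- `X` acts faithfully on the set of entries, i.e. `X ∩ S_q^m = 1`. -/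
def EntryFaithful (m q : ℕ) (X : Subgroup (Perm (V m q))) : Prop :=
  ∀ x ∈ X, (∃ g, x = hAut m q g 1) → x = 1

/-- The image of `X` in `S_m` under the entry action `μ`. -/
def entryImage (m q : ℕ) (X : Subgroup (Perm (V m q))) : Set (Perm (Fin m)) :=
  {σ | ∃ x ∈ X, ∃ g, x = hAut m q g σ}

/-- Two codes are equivalent if one is the image of the other under an
automorphism of the Hamming graph. -/
def CodeEquiv (m q : ℕ) (C C' : Set (V m q)) : Prop :=
  ∃ x ∈ HammingAut m q, x '' C = C'

/-- The repetition code: all constant tuples. -/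
def RepCode (m q : ℕ) : Set (V m q) := {α | ∃ a, α = fun _ => a}

/-- The zero vertex. -/
def zeroV (m q : ℕ) [NeZero q] : V m q := fun _ => 0

/-- The weight of a vertex: the number of nonzero entries. -/
noncomputable def wt (m q : ℕ) [NeZero q] (α : V m q) : ℕ :=
  hammingNorm α

/-- `α` covers `ν` if `α` agrees with `ν` on every nonzero entry of `ν`. -/
def Covers (m q : ℕ) [NeZero q] (α ν : V m q) : Prop :=
  ∀ i, ν i ≠ 0 → ν i = α i

/-- A `q`-ary `s-(m,k,λ)` design: a set of weight-`k` vertices such that every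
weight-`s` vertex is covered by exactly `λ` of them. -/
noncomputable def IsDesign (m q : ℕ) [NeZero q] (s k lam : ℕ) (D : Set (V m q)) : Prop :=
  (∀ α ∈ D, wt m q α = k) ∧
    ∀ ν : V m q, wt m q ν = s → {α ∈ D | Covers m q α ν}.ncard = lam

/-- `C` is `s`-regular: for each `i ≤ s` and `k ≤ m`, the number
`|Γ_k(ν) ∩ C|` is the same for all `ν ∈ C_i`. -/
def SRegular (m q : ℕ) (C : Set (V m q)) (s : ℕ) : Prop :=
  ∀ i ≤ s, ∀ k ≤ m, ∀ ν ∈ cell m q C i, ∀ μ ∈ cell m q C i,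
    {β ∈ C | hammingDist ν β = k}.ncard = {β ∈ C | hammingDist μ β = k}.ncard

/-- The automorphism group of a code: the setwise stabiliser of `C` in the
automorphism group of the Hamming graph. -/
def AutCode (m q : ℕ) (C : Set (V m q)) : Subgroup (Perm (V m q)) where
  carrier := {x | x ∈ HammingAut m q ∧ x '' C = C}
  one_mem' := ⟨(HammingAut m q).one_mem, by simp⟩
  mul_mem' := by
    rintro x y ⟨hx, hx'⟩ ⟨hy, hy'⟩
    exact ⟨mul_mem hx hy, by rw [Perm.coe_mul, Set.image_comp, hy', hx']⟩
  inv_mem' := by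
    rintro x ⟨hx, hx'⟩
    refine ⟨inv_mem hx, ?_⟩
    conv_lhs => rw [← hx']
    rw [← Set.image_comp]
    simp [Perm.inv_def]

/-- `N` is a minimal normal subgroup of the (sub)group `H`. -/
def IsMinNormalIn {G : Type*} [Group G] (H N : Subgroup G) : Prop :=
  N ≤ H ∧ N ≠ ⊥ ∧ (∀ h ∈ H, ∀ n ∈ N, h * n * h⁻¹ ∈ N) ∧
    ∀ K : Subgroup G, K ≤ H → K ≠ ⊥ →
      (∀ h ∈ H, ∀ k ∈ K, h * k * h⁻¹ ∈ K) → K ≤ N → K = N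

/-- The socle of a subgroup `H`: the subgroup generated by all minimal
normal subgroups of `H`. -/
def socleIn {G : Type*} [Group G] (H : Subgroup G) : Subgroup G :=
  ⨆ N ∈ {N : Subgroup G | IsMinNormalIn H N}, N

/-- A row of the punctured Hadamard 12 code: the binary vector whose entry at
`a ∈ F₁₁` is `1` exactly when `a - b` is a square in `F₁₁` (including `0`),
corresponding to the translate by `b` of the first row of the normalised Paley
Hadamard matrix of order 12 (with the `*` coordinate deleted, and with the
Hadamard entry `-1` encoded as `1`, `1` as `0`). -/
def hadRow (b : ZMod 11) : V 11 2 :=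
  fun i => if ∃ c : ZMod 11, c ^ 2 = ((i : ℕ) : ZMod 11) - b then 1 else 0

/-- The punctured Hadamard code of length 12 in `H(11,2)`: the zero vector and
all-ones vector (from the all-`(-1)` row of `-H₁₂` and of `H₁₂`), the eleven
weight-6 rows `hadRow b`, and their complements (the rows of `-H₁₂`). -/
def PHad : Set (V 11 2) :=
  {(fun _ => 0), (fun _ => 1)} ∪ Set.range hadRow ∪
    Set.range (fun b => (fun i => 1 - hadRow b i : V 11 2))

/-- The even weight subcode of the punctured Hadamard code of length 12: the
zero vector together with the eleven weight-6 codewords. -/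
def ESub : Set (V 11 2) :=
  insert (fun _ => 0) (Set.range hadRow)

end NT

namespace NT

lemma exists_differs_exactly_on {m q : ℕ} (hq : 2 ≤ q) (I : Finset (Fin m)) (α : V m q) :
    ∃ ν : V m q, ∀ j, ν j ≠ α j ↔ j ∈ I := by
  have : Nontrivial (Fin q) := Fin.nontrivial_iff_two_le.mpr hq
  choose f hf using fun a : Fin q => exists_ne a
  refine ⟨fun j => if j ∈ I then f (α j) else α j, fun j => ?_⟩
  by_cases hj : j ∈ I <;> simp [hj, hf]

lemma hammingDist_eq_card {m q : ℕ} {I : Finset (Fin m)} {α ν : V m q}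
    (h : ∀ j, ν j ≠ α j ↔ j ∈ I) : hammingDist ν α = I.card := by
  unfold hammingDist
  congr 1
  ext j
  simpa using h j

lemma minDist_le {m q : ℕ} {C : Set (V m q)} {α β : V m q} (hα : α ∈ C) (hβ : β ∈ C)
    (h : α ≠ β) : minDist m q C ≤ hammingDist α β :=
  Nat.sInf_le ⟨α, hα, β, hβ, h, rfl⟩

lemma mem_cell_of_hammingDist {m q r : ℕ} {C : Set (V m q)} {α ν : V m q} (hα : α ∈ C)
    (hν : hammingDist ν α = r) (hr : 2 * r ≤ minDist m q C) : ν ∈ cell m q C r := by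
  refine le_antisymm (Nat.sInf_le ⟨α, hα, hν⟩) (le_csInf ⟨_, α, hα, rfl⟩ ?_)
  rintro d ⟨γ, hγ, rfl⟩
  by_cases hne : α = γ
  · exact (hne ▸ hν).ge
  · have h1 := minDist_le hα hγ hne
    have h2 := hammingDist_triangle_left α γ ν
    omega

lemma hammingDist_hAut {m q : ℕ} (g : Fin m → Perm (Fin q)) (σ : Perm (Fin m))
    (α β : V m q) : hammingDist (hAut m q g σ α) (hAut m q g σ β) = hammingDist α β := by
  unfold hammingDist
  refine Finset.card_equiv σ⁻¹ fun j => ?_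
  simp [hAut]

end NT

open NT Equiv in
/-- Corollary 2.6: for `1 ≤ i ≤ min{s, ⌊(δ-1)/2⌋}` and any `i`-subset
`I` of `M`, the setwise stabiliser `X_I` acts transitively on `C`. -/
theorem stmt_5 (m q : ℕ) (hm : 2 ≤ m) (hq : 2 ≤ q)
    (X : Subgroup (Perm (V m q))) (C : Set (V m q)) (s : ℕ)
    (hNT : IsNT m q X C s)
    (i : ℕ) (hi1 : 1 ≤ i) (his : i ≤ s) (hiδ : i ≤ (minDist m q C - 1) / 2)
    (I : Finset (Fin m)) (hI : I.card = i) :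
    ∀ α ∈ C, ∀ β ∈ C, ∃ x ∈ X,
      (∃ g σ, x = hAut m q g σ ∧ I.image σ = I) ∧ x α = β := by
  subst hI
  intro α hα β hβ
  obtain ⟨hX, hC, hcell⟩ := hNT
  obtain ⟨ν, hν⟩ := exists_differs_exactly_on hq I α
  obtain ⟨μ, hμ⟩ := exists_differs_exactly_on hq I β
  have hdν := hammingDist_eq_card hν
  have hdμ := hammingDist_eq_card hμ
  obtain ⟨x, hx, hxν⟩ := (hcell _ hi1 his).2.2
    ν (mem_cell_of_hammingDist hα hdν (by omega)) μ (mem_cell_of_hammingDist hβ hdμ (by omega))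
  obtain ⟨g, σ, rfl⟩ := hX hx
  have hxα : hAut m q g σ α = β := by
    by_contra hne
    have h1 := minDist_le (hC.2.1 _ hx α hα) hβ hne
    have h2 := hammingDist_triangle_left (hAut m q g σ α) β μ
    have h3 := hammingDist_hAut g σ ν α
    rw [hxν] at h3
    omega
  refine ⟨_, hx, ⟨g, σ, rfl, ?_⟩, hxα⟩
  ext j
  have hj : σ⁻¹ j ∈ I ↔ j ∈ I := by
    rw [← hν, ← hμ, ← hxν, ← hxα]
    simp [hAut]
  rw [← hj, Finset.mem_image]
  constructor
  · rintro ⟨k, hk, rfl⟩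
    simpa using hk
  · exact fun h => ⟨_, h, by simp⟩
end

section
/- Let C be an (X,2)-neighbour transitive code in H(m,q) with minimum distance δ ≥ 5 and with the zero vertex 0 ∈ C. Then (m choose 2)·(q−1)^2 divides |X_0|, the order of the stabiliser in X of the zero codeword, and hence divides |X|. In particular, if |X_0| = m(m−1)/2 then q = 2. -/
open Equiv

namespace NT

lemma hammingDist_map_of_mem {m q : ℕ} {x : Perm (V m q)} (hx : x ∈ HammingAut m q)
    (α β : V m q) : hammingDist (x α) (x β) = hammingDist α β := by
  obtain ⟨g, σ, rfl⟩ := hx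
  exact hammingDist_hAut g σ α β

lemma eq_of_hammingDist_le {m q e : ℕ} {C : Set (V m q)} (hC : 2 * e < minDist m q C)
    {α β ν : V m q} (hα : α ∈ C) (hβ : β ∈ C) (hνα : hammingDist ν α ≤ e)
    (hνβ : hammingDist ν β ≤ e) : α = β := by
  by_contra h
  have h1 := minDist_le hα hβ h
  have h2 := hammingDist_triangle_left α β ν
  omega

lemma mem_cell_of_hammingDist_eq {m q e : ℕ} {C : Set (V m q)} (hC : 2 * e < minDist m q C)
    {α ν : V m q} (hα : α ∈ C) (hν : hammingDist ν α = e) : ν ∈ cell m q C e := by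
  refine le_antisymm (Nat.sInf_le ⟨α, hα, hν⟩) (le_csInf ⟨e, α, hα, hν⟩ ?_)
  rintro d ⟨β, hβ, rfl⟩
  by_contra! h
  obtain rfl := eq_of_hammingDist_le hC hα hβ hν.le h.le
  omega

/-- If `C_e` is an `X`-orbit with `2e < δ`, the stabiliser in `X` of a codeword `α` is
transitive on the sphere of radius `e` centred at `α`. -/
lemma orbit_inf_stabilizer_eq_sphere {m q e : ℕ} {X : Subgroup (Perm (V m q))}
    {C : Set (V m q)} (hX : X ≤ HammingAut m q) (hC : 2 * e < minDist m q C)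
    (hXC : ∀ x ∈ X, ∀ β ∈ C, x β ∈ C) (hcell : IsOrbit m q X (cell m q C e))
    {α ν : V m q} (hα : α ∈ C) (hν : hammingDist ν α = e) :
    MulAction.orbit ↥(X ⊓ MulAction.stabilizer (Perm (V m q)) α) ν =
      {μ | hammingDist μ α = e} := by
  ext μ
  constructor
  · rintro ⟨⟨x, hx, hxα⟩, rfl⟩
    have hxα : x α = α := hxα
    have h := hammingDist_map_of_mem (hX hx) ν α
    rw [hxα, hν] at h
    exact h
  · intro (hμ : hammingDist μ α = e)
    obtain ⟨x, hx, rfl⟩ := hcell.2.2 ν (mem_cell_of_hammingDist_eq hC hα hν) μ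
      (mem_cell_of_hammingDist_eq hC hα hμ)
    have h := hammingDist_map_of_mem (hX hx) ν α
    have hxα : x α = α :=
      eq_of_hammingDist_le hC (hXC x hx α hα) hα (h.trans hν).le hμ.le
    exact ⟨⟨x, hx, hxα⟩, rfl⟩

lemma ncard_hammingNorm_eq (m q k : ℕ) [NeZero q] :
    {α : V m q | hammingNorm α = k}.ncard = m.choose k * (q - 1) ^ k := by
  classical
  rw [Set.ncard_eq_toFinset_card', Set.toFinset_ofPred,
    Finset.card_eq_sum_card_fiberwise
      (f := fun α : V m q => Finset.univ.filter fun i => α i ≠ 0)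
      (t := Finset.powersetCard k Finset.univ)]
  · rw [Finset.sum_congr rfl (g := fun _ => (q - 1) ^ k)]
    · simp
    · intro S hS
      have hS : S.card = k := (Finset.mem_powersetCard.1 hS).2
      have : ((Finset.univ.filter fun α : V m q => hammingNorm α = k).filter
          fun α => (Finset.univ.filter fun i => α i ≠ 0) = S) =
          Fintype.piFinset fun i => if i ∈ S then ({0}ᶜ : Finset (Fin q)) else {0} := by
        ext α
        simp only [Finset.mem_filter, Finset.mem_univ, true_and, Fintype.mem_piFinset]
        constructor
        · rintro ⟨-, rfl⟩ i
          by_cases h : α i = 0 <;> simp [h]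
        · intro h
          have hα : (Finset.univ.filter fun i => α i ≠ 0) = S := by
            ext i
            have := h i
            by_cases hi : i ∈ S <;> simp_all
          refine ⟨?_, hα⟩
          rw [hammingNorm, hα, hS]
      rw [this, Fintype.card_piFinset]
      simp [apply_ite Finset.card, Finset.card_compl, hS]
  · intro α hα
    simpa [Finset.mem_powersetCard, hammingNorm] using hα

end NT

open NT Equiv in
/-- Lemma 2.10: for an `(X,2)`-neighbour transitive code with `δ ≥ 5`
and `0 ∈ C`, `(m choose 2)(q-1)²` divides `|X₀|` and hence `|X|`; moreover if
`|X₀| = m(m-1)/2` then `q = 2`. -/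
theorem stmt_8 (m q : ℕ) [NeZero q] (hm : 2 ≤ m) (hq : 2 ≤ q)
    (X : Subgroup (Perm (V m q))) (C : Set (V m q))
    (hδ : 5 ≤ minDist m q C) (hNT : IsNT m q X C 2) (h0 : zeroV m q ∈ C) :
    (m.choose 2 * (q - 1) ^ 2 ∣
      Nat.card ↥(X ⊓ MulAction.stabilizer (Perm (V m q)) (zeroV m q))) ∧
    (m.choose 2 * (q - 1) ^ 2 ∣ Nat.card ↥X) ∧
    (Nat.card ↥(X ⊓ MulAction.stabilizer (Perm (V m q)) (zeroV m q)) = m * (m - 1) / 2 →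
      q = 2) := by
  obtain ⟨hX, hCorb, hcells⟩ := hNT
  have hcard := ncard_hammingNorm_eq m q 2
  have hpos : 0 < m.choose 2 := Nat.choose_pos hm
  have hsphere : {μ : V m q | hammingDist μ (zeroV m q) = 2} = {μ | hammingNorm μ = 2} := by
    ext μ
    exact Eq.congr_left (hammingDist_zero_right μ)
  obtain ⟨ν, hν⟩ : {μ : V m q | hammingDist μ (zeroV m q) = 2}.Nonempty := by
    have : 0 < (q - 1) ^ 2 := pow_pos (by omega) 2
    rw [hsphere, ← Set.ncard_pos, hcard]
    positivity
  have hdvd : m.choose 2 * (q - 1) ^ 2 ∣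
      Nat.card ↥(X ⊓ MulAction.stabilizer (Perm (V m q)) (zeroV m q)) := by
    rw [← hcard, ← hsphere, ← orbit_inf_stabilizer_eq_sphere hX (by omega) hCorb.2.1
      (hcells 2 one_le_two le_rfl) h0 hν, ← MulAction.index_stabilizer]
    exact Subgroup.index_dvd_card _
  refine ⟨hdvd, hdvd.trans (Subgroup.card_dvd_of_le inf_le_left), fun h => ?_⟩
  rw [h, ← Nat.choose_two_right] at hdvd
  have h1 : (q - 1) ^ 2 ∣ 1 := Nat.dvd_of_mul_dvd_mul_left hpos (by simpa using hdvd)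
  have h2 : q - 1 = 1 := (Nat.pow_eq_one.1 (Nat.dvd_one.1 h1)).resolve_right two_ne_zero
  omega
end
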